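/- Let X be a random variable on Ω with values in a countable (discrete) measurable space, and Y a random variable with values in some measurable space, such that: (i) the pair (X, Y) satisfies distributional consistency (jointly); and (ii) conditional ignorability holds: for all t, t* ∈ {0,1} and every value x with μ_t(X = x, T* = t*) > 0 and every measurable set A, μ_t(Y ∈ A | X = x, T* = t*) = μ_t(Y ∈ A | X = x). Then Y ⊥ (T*, F_T) | (X, T): for every regime r ∈ {0, 1, e}, all t, t* ∈ {0,1}, every value x with μ_r(X = x, T = t, T* = t*) > 0, and every measurable set A, μ_r(Y ∈ A | X = x, T = t, T* = t*) = μ_t(Y ∈ A | X = x). (Lemma 3, second assertion: X is a sufficient covariate.) -/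

import Mathlib

open MeasureTheory ProbabilityTheory

theorem ProbabilityTheory.cond_congr_ae {Ω : Type*} [MeasurableSpace Ω] {μ : Measure Ω}
    {s t : Set Ω} (h : s =ᵐ[μ] t) : μ[|s] = μ[|t] := by
  simp only [ProbabilityTheory.cond, Measure.restrict_congr_set h, measure_congr h]

theorem ProbabilityTheory.measure_inter_eq_of_cond_eq {Ω : Type*} [MeasurableSpace Ω]
    {μ ν : Measure Ω} [IsFiniteMeasure μ] [IsFiniteMeasure ν] {s t : Set Ω}
    (hs : MeasurableSet s) (hst : μ s = ν s) (h : μ[|s] t = ν[|s] t) :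
    μ (s ∩ t) = ν (s ∩ t) := by
  rw [← cond_mul_eq_inter hs t μ, ← cond_mul_eq_inter hs t ν, h, hst]

/-- **Lemma 3, second assertion.** In a three-regime treatment model, let `X`
be a discrete-valued covariate and `Y` a response such that the pair `(X, Y)` satisfies
distributional consistency jointly, and conditional ignorability holds:
`μ_t(Y ∈ A | X = x, T* = t*) = μ_t(Y ∈ A | X = x)`.  Then `Y ⫫ (T*, F_T) | (X, T)`: in every
regime `r`, `μ_r(Y ∈ A | X = x, T = t, T* = t*) = μ_t(Y ∈ A | X = x)`. -/
theorem dt_sufficient_covariate_Y_indep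
    {Ω : Type*} [MeasurableSpace Ω]
    {γ : Type*} [MeasurableSpace γ] [Countable γ] [MeasurableSingletonClass γ]
    {β : Type*} [MeasurableSpace β]
    (μ0 μ1 μe : Measure Ω)
    [IsProbabilityMeasure μ0] [IsProbabilityMeasure μ1] [IsProbabilityMeasure μe]
    (T Tstar : Ω → Bool) (hT : Measurable T) (hTstar : Measurable Tstar)
    (hT0 : ∀ᵐ ω ∂μ0, T ω = false)
    (hT1 : ∀ᵐ ω ∂μ1, T ω = true)
    (hTe : ∀ᵐ ω ∂μe, T ω = Tstar ω)
    (hTstarDist : ∀ t : Bool,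
      μ0 {ω | Tstar ω = t} = μe {ω | Tstar ω = t} ∧
      μ1 {ω | Tstar ω = t} = μe {ω | Tstar ω = t})
    (X : Ω → γ) (hX : Measurable X) (Y : Ω → β) (hY : Measurable Y)
    (hDC : ∀ t : Bool, 0 < μe {ω | Tstar ω = t} →
      ∀ A : Set (γ × β), MeasurableSet A →
        μe[|{ω | Tstar ω = t}] {ω | (X ω, Y ω) ∈ A} =
          (bif t then μ1 else μ0)[|{ω | Tstar ω = t}] {ω | (X ω, Y ω) ∈ A})
    (hCondIgn : ∀ t tstar : Bool, ∀ x : γ,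
      0 < (bif t then μ1 else μ0) {ω | X ω = x ∧ Tstar ω = tstar} →
      ∀ A : Set β, MeasurableSet A →
        (bif t then μ1 else μ0)[|{ω | X ω = x ∧ Tstar ω = tstar}] {ω | Y ω ∈ A} =
          (bif t then μ1 else μ0)[|{ω | X ω = x}] {ω | Y ω ∈ A}) :
    ∀ μr ∈ ({μ0, μ1, μe} : Set (Measure Ω)), ∀ t tstar : Bool, ∀ x : γ,
      0 < μr {ω | X ω = x ∧ T ω = t ∧ Tstar ω = tstar} →
      ∀ A : Set β, MeasurableSet A →
        μr[|{ω | X ω = x ∧ T ω = t ∧ Tstar ω = tstar}] {ω | Y ω ∈ A} =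
          (bif t then μ1 else μ0)[|{ω | X ω = x}] {ω | Y ω ∈ A} := by
  have hTstar_eq (s : Bool) : MeasurableSet {ω | Tstar ω = s} :=
    hTstar (measurableSet_singleton s)
  have hX_eq (x : γ) : MeasurableSet {ω | X ω = x} := hX (measurableSet_singleton x)
  have hint : ∀ t' t tstar : Bool, ∀ x : γ,
      0 < (bif t' then μ1 else μ0) {ω | X ω = x ∧ T ω = t ∧ Tstar ω = tstar} →
      ∀ A : Set β, MeasurableSet A →
        (bif t' then μ1 else μ0)[|{ω | X ω = x ∧ T ω = t ∧ Tstar ω = tstar}] {ω | Y ω ∈ A} =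
          (bif t then μ1 else μ0)[|{ω | X ω = x}] {ω | Y ω ∈ A} := by
    intro t' t tstar x hpos A hA
    have hT' : ∀ᵐ ω ∂(bif t' then μ1 else μ0), T ω = t' := by
      cases t'
      · exact hT0
      · exact hT1
    obtain ⟨ω, ⟨-, hωt, -⟩, hωt'⟩ :=
      ((frequently_ae_mem_iff.2 hpos.ne').and_eventually hT').exists
    obtain rfl : t' = t := hωt'.symm.trans hωt
    have hset : {ω | X ω = x ∧ T ω = t' ∧ Tstar ω = tstar}
        =ᵐ[bif t' then μ1 else μ0] {ω | X ω = x ∧ Tstar ω = tstar} := by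
      refine Filter.eventuallyEq_set.2 ?_
      filter_upwards [hT'] with ω hω
      simp [hω]
    rw [cond_congr_ae hset]
    rw [measure_congr hset] at hpos
    exact hCondIgn t' tstar x hpos A hA
  intro μr hr t tstar x hpos A hA
  rcases hr with rfl | rfl | rfl
  · exact hint false t tstar x hpos A hA
  · exact hint true t tstar x hpos A hA
  obtain ⟨ω, ⟨-, hωt, hωs⟩, hω⟩ :=
    ((frequently_ae_mem_iff.2 hpos.ne').and_eventually hTe).exists
  obtain rfl : t = tstar := hωt.symm.trans (hω.trans hωs)
  have hset : {ω | X ω = x ∧ T ω = t ∧ Tstar ω = t}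
      =ᵐ[μr] {ω | X ω = x ∧ Tstar ω = t} := by
    refine Filter.eventuallyEq_set.2 ?_
    filter_upwards [hTe] with ω hω
    simp [hω]
  rw [cond_congr_ae hset]
  rw [measure_congr hset] at hpos
  have hposT : 0 < μr {ω | Tstar ω = t} := hpos.trans_le (measure_mono fun ω h => h.2)
  have hfin : IsFiniteMeasure (bif t then μ1 else μ0) := by
    cases t <;> simp only [cond_true, cond_false] <;> infer_instance
  have hdist : μr {ω | Tstar ω = t} = (bif t then μ1 else μ0) {ω | Tstar ω = t} := by
    cases t
    · exact (hTstarDist false).1.symm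
    · exact (hTstarDist true).2.symm
  have hjoint (B : Set β) (hB : MeasurableSet B) :
      μr ({ω | X ω = x ∧ Tstar ω = t} ∩ {ω | Y ω ∈ B}) =
        (bif t then μ1 else μ0) ({ω | X ω = x ∧ Tstar ω = t} ∩ {ω | Y ω ∈ B}) := by
    have h := measure_inter_eq_of_cond_eq (hTstar_eq t) hdist
      (hDC t hposT ({x} ×ˢ B) ((measurableSet_singleton x).prod hB))
    convert h using 2 <;>
    · ext ω
      simp only [Set.mem_inter_iff, Set.mem_ofPred_eq, Set.mem_prod, Set.mem_singleton_iff]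
      tauto
  have hmarg : μr {ω | X ω = x ∧ Tstar ω = t} =
      (bif t then μ1 else μ0) {ω | X ω = x ∧ Tstar ω = t} := by
    simpa using hjoint Set.univ MeasurableSet.univ
  have hmeas : MeasurableSet {ω | X ω = x ∧ Tstar ω = t} := (hX_eq x).inter (hTstar_eq t)
  rw [← hCondIgn t t x (hmarg ▸ hpos) A hA, cond_apply hmeas, cond_apply hmeas,
    hjoint A hA, hmarg]
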